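/- Let X = ℕ × {−1, 0, +1} with x_n^+ = (n,+1), x_n^- = (n,−1), z_n = (n,0); let U(x_n^+) = {x_n^+, z_n}, U(x_n^-) = {x_n^-, z_n}, U(z_n) = {z_n, x_n^+, x_n^-}; and let C = {h_y : y ∈ {−1,+1}^ℕ} where h_y(x_n^+) = +1, h_y(x_n^-) = −1, h_y(z_n) = y(n). Then for every k ∈ ℕ, the points z_1, ..., z_k are U-robustly shattered by C; consequently the U-robust shattering dimension of C is infinite. -/

import Mathlib

open MeasureTheory

instance : MeasurableSpace SignType := ⊤
instance : MeasurableSpace ℤˣ := ⊤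

/-- The instance space `X = ℕ × {−1, 0, +1}`, with second coordinate formalized by `SignType`
(`.neg ↔ −1`, `.zero ↔ 0`, `.pos ↔ +1`). Binary labels are formalized as `ℤˣ = {−1,+1}`. -/
abbrev Xsp : Type := ℕ × SignType

/-- `x_n^+ = (n, +1)`. -/
def xp (n : ℕ) : Xsp := (n, SignType.pos)

/-- `x_n^- = (n, −1)`. -/
def xm (n : ℕ) : Xsp := (n, SignType.neg)

/-- `z_n = (n, 0)`. -/
def zz (n : ℕ) : Xsp := (n, SignType.zero)

/-- The perturbation set: `U(x_n^±) = {x_n^±, z_n}` and `U(z_n) = {z_n, x_n^+, x_n^-}`. -/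
def Upert : Xsp → Set Xsp := fun p =>
  match p with
  | (n, SignType.pos) => {xp n, zz n}
  | (n, SignType.neg) => {xm n, zz n}
  | (n, SignType.zero) => {zz n, xp n, xm n}

/-- The concept `h_y` for `y : ℕ → ℤˣ`: `h_y(x_n^+) = +1`, `h_y(x_n^-) = −1`,
`h_y(z_n) = y(n)`. -/
def hy (y : ℕ → ℤˣ) : Xsp → ℤˣ := fun p =>
  match p with
  | (_, SignType.pos) => 1
  | (_, SignType.neg) => -1
  | (n, SignType.zero) => y n

/-- `x_n^{u}` for a sign `u : ℤˣ`: `x_n^{+1} = x_n^+` and `x_n^{−1} = x_n^-`. -/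
def xpt (n : ℕ) (u : ℤˣ) : Xsp := if u = 1 then xp n else xm n

/-- Robust region of a classifier `h` w.r.t. a perturbation set `V`. -/
def Rob {X Y : Type*} (V : X → Set X) (h : X → Y) : Set X := {x | ∀ z ∈ V x, h z = h x}

/-- A `k`-tuple of points `z` is `U`-robustly shattered by a class `C`: there are witness
points `x_i^+, x_i^-` with `z_i ∈ U(x_i^+) ∩ U(x_i^-)` such that every sign pattern is realized
by some `h ∈ C` robustly on the corresponding witness points. -/
def RobustlyShattered {X : Type*} (U : X → Set X) (C : Set (X → ℤˣ)) {k : ℕ}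
    (z : Fin k → X) : Prop :=
  ∃ xplus xminus : Fin k → X,
    (∀ i, z i ∈ U (xplus i) ∧ z i ∈ U (xminus i)) ∧
    ∀ ys : Fin k → ℤˣ, ∃ h ∈ C,
      ∀ i, ∀ z' ∈ U (if ys i = 1 then xplus i else xminus i), h z' = ys i

/-- In the hard construction, for every `k` the points `z_1, …, z_k` are `U`-robustly shattered
by `C = {h_y : y ∈ {−1,+1}^ℕ}`; consequently the `U`-robust shattering dimension of `C`
is infinite. -/
theorem construction_shattering :
    (∀ k : ℕ, RobustlyShattered Upert (Set.range hy) (fun i : Fin k => zz i)) ∧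
    (⨆ k ∈ {k : ℕ | ∃ z : Fin k → Xsp, RobustlyShattered Upert (Set.range hy) z},
      (k : ℕ∞)) = ⊤ := by
  have shattered : ∀ k : ℕ,
      RobustlyShattered Upert (Set.range hy) (fun i : Fin k => zz i) := by
    intro k
    refine ⟨fun i => xp i, fun i => xm i, fun i => ⟨.inr rfl, .inr rfl⟩, fun ys => ?_⟩
    refine ⟨_, ⟨fun n => if h : n < k then ys ⟨n, h⟩ else 1, rfl⟩, fun i z' hz' => ?_⟩
    rcases Int.units_eq_one_or (ys i) with h | h
    · rw [if_pos h] at hz'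
      rcases hz' with rfl | rfl
      · exact h.symm
      · exact dif_pos i.isLt
    · rw [if_neg (by rw [h]; decide)] at hz'
      rcases hz' with rfl | rfl
      · exact h.symm
      · exact dif_pos i.isLt
  refine ⟨shattered, ENat.eq_top_iff_forall_ge.2 fun k => ?_⟩
  exact le_iSup₂_of_le k ⟨_, shattered k⟩ le_rfl
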